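/- arXiv:0911.1737 — 3 statements merged into one kernel-verified Lean document; each statement's English description precedes it below -/
import Mathlib

section
/- For all positive integers n and k, the n×n determinant over ℚ with (i,j)-entry (2k)/(i+j+k+1)·C(2i+2j+1, i+j+k), for 0 ≤ i, j ≤ n−1, equals (−1)^{n₁·C(k,2)} if n = n₁k for a positive integer n₁, and equals 0 if k does not divide n. -/
open Polynomial

/-- The sign of the order-reversing permutation of `Fin n`. -/
theorem sign_fin_revPerm (n : ℕ) :
    Equiv.Perm.sign (Fin.revPerm : Equiv.Perm (Fin n)) = (-1) ^ n.choose 2 := by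
  rw [Equiv.Perm.sign_eq_prod_prod_Iio]
  have h (j : Fin n) : (∏ i ∈ Finset.Iio j,
      if Fin.revPerm i < Fin.revPerm j then (1 : ℤˣ) else -1) = (-1) ^ (j : ℕ) := by
    rw [Finset.prod_congr rfl (g := fun _ => (-1 : ℤˣ))]
    · simp
    · intro i hi
      have hi := Finset.mem_Iio.1 hi
      simp [hi.le]
  simp_rw [h]
  rw [Finset.prod_pow_eq_pow_sum, Fin.sum_univ_eq_sum_range (fun i => i) n,
    Finset.sum_range_id, Nat.choose_two_right]

namespace Polynomial.Chebyshev

variable (R : Type*) [CommRing R]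

theorem monic_natDegree_S [Nontrivial R] (n : ℕ) :
    (S R n).Monic ∧ (S R n).natDegree = n := by
  induction n using Nat.twoStepInduction with
  | zero => simp
  | one => simp
  | more n ih₀ ih₁ =>
    have hd : (X * S R (n + 1 : ℕ)).natDegree = n + 2 := by
      rw [monic_X.natDegree_mul ih₁.1, ih₁.2, natDegree_X]; ring
    have hlt : (S R n).natDegree < (X * S R (n + 1 : ℕ)).natDegree := by omega
    have heq : S R (n + 2 : ℕ) = X * S R (n + 1 : ℕ) - S R n := by
      push_cast; exact S_add_two R n
    rw [heq]
    exact ⟨(monic_X.mul ih₁.1).sub_of_left (degree_lt_degree hlt),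
      (natDegree_sub_eq_left_of_natDegree_lt hlt).trans hd⟩

theorem monic_natDegree_C [Nontrivial R] {n : ℕ} (hn : 0 < n) :
    (C R n).Monic ∧ (C R n).natDegree = n := by
  obtain rfl | ⟨m, rfl⟩ : n = 1 ∨ ∃ m, n = m + 2 := by
    rcases n with _ | _ | m
    · omega
    · exact Or.inl rfl
    · exact Or.inr ⟨m, rfl⟩
  · simp
  · obtain ⟨h₂, hd₂⟩ := monic_natDegree_S R (m + 2)
    obtain ⟨h₀, hd₀⟩ := monic_natDegree_S R m
    have hlt : (S R m).natDegree < (S R (m + 2 : ℕ)).natDegree := by omega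
    have heq : C R (m + 2 : ℕ) = S R (m + 2 : ℕ) - S R m := by
      rw [C_eq_S_sub_X_mul_S]
      push_cast
      rw [S_add_two, show (m : ℤ) + 2 - 1 = m + 1 by ring]
      ring
    rw [heq]
    exact ⟨h₂.sub_of_left (degree_lt_degree hlt),
      (natDegree_sub_eq_left_of_natDegree_lt hlt).trans hd₂⟩

theorem C_mul_S (m n : ℤ) : C R m * S R n = S R (n + m) + S R (n - m) := by
  induction m using Chebyshev.induct' with
  | zero => simp [two_mul]
  | one => rw [C_one, S_add_one]; ring
  | add_two m ih₁ ih₀ =>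
    have h₁ := S_add_two R (n + m)
    have h₂ := S_sub_two R (n - m)
    rw [C_add_two, sub_mul, mul_assoc, ih₁, ih₀, show n + ((m : ℤ) + 2) = n + m + 2 by ring,
      show n - ((m : ℤ) + 2) = n - m - 2 by ring, h₁, h₂,
      show n + ((m : ℤ) + 1) = n + m + 1 by ring, show n - ((m : ℤ) + 1) = n - m - 1 by ring]
    ring
  | neg m ih => rw [C_neg, ih, sub_neg_eq_add, ← sub_eq_add_neg, add_comm]

theorem S_comp_C_mul_S (a : ℕ) (k : ℤ) :
    (S R a).comp (C R k) * S R (k - 1) = S R ((a + 1) * k - 1) := by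
  induction a using Nat.twoStepInduction with
  | zero => simp
  | one =>
    simp only [Nat.cast_one, S_one, X_comp, C_mul_S]
    rw [show k - 1 - k = (-1 : ℤ) by ring, S_neg_one, add_zero]
    congr 1; ring
  | more a ih₀ ih₁ =>
    have h := C_mul_S R k (((a + 1 : ℕ) + 1) * k - 1)
    push_cast at h ih₁ ⊢
    rw [S_add_two, sub_comp, mul_comp, X_comp, sub_mul, mul_assoc, ih₁, ih₀, h,
      show ((a : ℤ) + 1 + 1) * k - 1 - k = (a + 1) * k - 1 by ring, add_sub_cancel_right]
    congr 1; ring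

end Polynomial.Chebyshev

open Polynomial.Chebyshev

/-- The ballot number `C(2m+1, m+k) - C(2m+1, m+k+1)`. -/
def ballotNumber (m k : ℕ) : ℚ :=
  ((2 * m + 1).choose (m + k) : ℚ) - (2 * m + 1).choose (m + k + 1)

theorem ballotNumber_eq (m k : ℕ) :
    (2 * k : ℚ) / ((m + k + 1 : ℕ) : ℚ) * ((2 * m + 1).choose (m + k) : ℚ) =
      ballotNumber m k := by
  have h := Nat.choose_succ_right_eq (2 * m + 1) (m + k)
  have hq : ((2 * m + 1).choose (m + k + 1) : ℚ) * (m + k + 1) =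
      (2 * m + 1).choose (m + k) * (m + 1 - k) := by
    rcases le_or_gt (m + k) (2 * m + 1) with hle | hlt
    · have h' := congrArg (Nat.cast (R := ℚ)) h
      push_cast [Nat.cast_sub hle] at h'
      rw [h']; ring
    · rw [Nat.choose_eq_zero_of_lt hlt, Nat.choose_eq_zero_of_lt (by omega)]; simp
  have hne : (m + k + 1 : ℚ) ≠ 0 := by positivity
  unfold ballotNumber
  push_cast
  field_simp
  linear_combination hq

theorem ballotNumber_zero_right (m : ℕ) : ballotNumber m 0 = 0 := by
  simp [ballotNumber, Nat.choose_symm_half]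

theorem ballotNumber_of_lt {m k : ℕ} (h : m + 1 < k) : ballotNumber m k = 0 := by
  rw [ballotNumber, Nat.choose_eq_zero_of_lt (by omega), Nat.choose_eq_zero_of_lt (by omega),
    sub_self]

theorem ballotNumber_succ_self (m : ℕ) : ballotNumber m (m + 1) = 1 := by
  rw [ballotNumber, Nat.choose_eq_zero_of_lt (k := m + (m + 1) + 1) (by omega),
    show m + (m + 1) = 2 * m + 1 by ring, Nat.choose_self]
  simp

theorem ballotNumber_succ_succ (m k : ℕ) :
    ballotNumber (m + 1) (k + 1) =
      ballotNumber m (k + 2) + 2 * ballotNumber m (k + 1) + ballotNumber m k := by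
  have h (j : ℕ) : (2 * (m + 1) + 1).choose (j + 2) =
      (2 * m + 1).choose j + 2 * (2 * m + 1).choose (j + 1) + (2 * m + 1).choose (j + 2) := by
    rw [show 2 * (m + 1) + 1 = 2 * m + 1 + 1 + 1 by ring, Nat.choose_succ_succ' _ (j + 1),
      Nat.choose_succ_succ' _ j, Nat.choose_succ_succ' _ (j + 1)]
    ring
  unfold ballotNumber
  rw [show m + 1 + (k + 1) = m + k + 2 by ring, h, show m + k + 2 + 1 = m + k + 1 + 2 by ring, h]
  push_cast
  ring_nf

/-- The linear functional on polynomials whose moments are the Catalan numbers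
`ballotNumber m 1`. -/
noncomputable def ballotFunctional : ℚ[X] →ₗ[ℚ] ℚ :=
  (basisMonomials ℚ).constr ℚ fun m => ballotNumber m 1

theorem ballotFunctional_X_pow (m : ℕ) : ballotFunctional (X ^ m) = ballotNumber m 1 := by
  rw [← monomial_one_right_eq_X_pow, ballotFunctional]
  exact (basisMonomials ℚ).constr_basis ℚ _ m

/-- The monic polynomials orthogonal with respect to `ballotFunctional`. -/
noncomputable def shiftedS (n : ℤ) : ℚ[X] := (S ℚ n).comp (X - 2)

theorem ballotFunctional_X_pow_mul_shiftedS (m l : ℕ) :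
    ballotFunctional (X ^ m * shiftedS l) = ballotNumber m (l + 1) := by
  have hX : X * (X - 2 : ℚ[X]) = X ^ 2 - 2 * X := by ring
  induction l using Nat.twoStepInduction generalizing m with
  | zero => simp [shiftedS, ballotFunctional_X_pow]
  | one =>
    have h : X ^ m * shiftedS (1 : ℕ) = X ^ (m + 1) - (2 : ℚ) • X ^ m := by
      simp only [shiftedS, Nat.cast_one, S_one, X_comp, smul_eq_C_mul, map_ofNat]
      ring
    have hb := ballotNumber_succ_succ m 0
    rw [ballotNumber_zero_right] at hb
    simp only [zero_add] at hb
    rw [h, map_sub, map_smul, ballotFunctional_X_pow, ballotFunctional_X_pow, hb, smul_eq_mul]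
    ring
  | more l ih₀ ih₁ =>
    have h : X ^ m * shiftedS (l + 2 : ℕ) = X ^ (m + 1) * shiftedS (l + 1 : ℕ) -
        (2 : ℚ) • (X ^ m * shiftedS (l + 1 : ℕ)) - X ^ m * shiftedS l := by
      simp only [shiftedS, Nat.cast_add, Nat.cast_ofNat, Nat.cast_one, S_add_two, sub_comp,
        mul_comp, X_comp, smul_eq_C_mul, map_ofNat]
      ring
    rw [h, map_sub, map_sub, map_smul, ih₀, ih₁, ih₁, ballotNumber_succ_succ, smul_eq_mul]
    ring

theorem sum_coeff_mul_ballotNumber {n : ℕ} {f : ℚ[X]} (hf : f.natDegree < n) (j k : ℕ) :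
    ∑ l : Fin n, f.coeff l * ballotNumber (l + j) (k + 1) =
      ballotFunctional (X ^ j * (f * shiftedS k)) := by
  rw [Fin.sum_univ_eq_sum_range (fun l => f.coeff l * ballotNumber (l + j) (k + 1)) n]
  conv_rhs => rw [f.as_sum_range_C_mul_X_pow' hf]
  rw [Finset.sum_mul, Finset.mul_sum, map_sum]
  refine Finset.sum_congr rfl fun l _ => ?_
  rw [← ballotFunctional_X_pow_mul_shiftedS, ← smul_eq_mul, ← map_smul, smul_eq_C_mul]
  congr 1
  ring

/-- The quotient `S_{(a+1)k-1}(X-2) / S_{k-1}(X-2)`. -/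
noncomputable def shiftedSQuotient (k a : ℕ) : ℚ[X] :=
  ((S ℚ a).comp (Chebyshev.C ℚ k)).comp (X - 2)

theorem monic_X_sub_two : (X - 2 : ℚ[X]).Monic ∧ (X - 2 : ℚ[X]).natDegree = 1 :=
  ⟨monic_X_sub_C (2 : ℚ), natDegree_X_sub_C (2 : ℚ)⟩

theorem monic_natDegree_shiftedSQuotient {k : ℕ} (hk : 0 < k) (a : ℕ) :
    (shiftedSQuotient k a).Monic ∧ (shiftedSQuotient k a).natDegree = a * k := by
  obtain ⟨hS, hSd⟩ := monic_natDegree_S ℚ a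
  obtain ⟨hC, hCd⟩ := monic_natDegree_C ℚ hk
  obtain ⟨hX, hXd⟩ := monic_X_sub_two
  refine ⟨(hS.comp hC (by omega)).comp hX (by omega), ?_⟩
  rw [shiftedSQuotient, natDegree_comp, natDegree_comp, hSd, hCd, hXd, mul_one]

theorem shiftedSQuotient_mul_shiftedS (k a : ℕ) :
    shiftedSQuotient k a * shiftedS (k - 1) = shiftedS ((a + 1) * k - 1) := by
  rw [shiftedSQuotient, shiftedS, ← mul_comp, S_comp_C_mul_S, shiftedS]

/-- A monic polynomial of degree `a * k + b` whose product with `S_{k-1}(X-2)` is sparse in the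
basis `shiftedS`. -/
noncomputable def sparsePolynomial (k a b : ℕ) : ℚ[X] :=
  shiftedSQuotient k a * if b = 0 then 1 else (Chebyshev.C ℚ b).comp (X - 2)

theorem monic_natDegree_sparsePolynomial {k : ℕ} (hk : 0 < k) (a b : ℕ) :
    (sparsePolynomial k a b).Monic ∧ (sparsePolynomial k a b).natDegree = a * k + b := by
  obtain ⟨h, hd⟩ := monic_natDegree_shiftedSQuotient hk a
  unfold sparsePolynomial
  split_ifs with hb
  · simp [h, hd, hb]
  · obtain ⟨hC, hCd⟩ := monic_natDegree_C ℚ (Nat.pos_of_ne_zero hb)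
    obtain ⟨hX, hXd⟩ := monic_X_sub_two
    have hc := hC.comp hX (by omega)
    exact ⟨h.mul hc, by rw [h.natDegree_mul hc, hd, natDegree_comp, hCd, hXd, mul_one]⟩

theorem sparsePolynomial_mul_shiftedS (k a b : ℕ) :
    sparsePolynomial k a b * shiftedS (k - 1) = shiftedS ((a + 1) * k - 1 - b) +
      if b = 0 then 0 else shiftedS ((a + 1) * k - 1 + b) := by
  have h := shiftedSQuotient_mul_shiftedS k a
  rw [sparsePolynomial, mul_right_comm, h]
  split_ifs with hb
  · simp [hb]
  · rw [shiftedS, mul_comm, ← mul_comp, C_mul_S, add_comp, add_comm]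
    rfl

theorem ballotFunctional_sparsePolynomial {k b : ℕ} (hb : b < k) (a j : ℕ) :
    ballotFunctional (X ^ j * (sparsePolynomial k a b * shiftedS (k - 1 : ℕ))) =
      ballotNumber j (a * k + (k - 1 - b) + 1) +
        if b = 0 then 0 else ballotNumber j (a * k + (k - 1) + b + 1) := by
  have h₁ : ((k - 1 : ℕ) : ℤ) = k - 1 := by omega
  have h₂ : ((a : ℤ) + 1) * k - 1 - b = (a * k + (k - 1 - b) : ℕ) := by
    rw [add_mul]; push_cast [Nat.cast_sub (show b ≤ k - 1 by omega), h₁]; ring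
  have h₃ : ((a : ℤ) + 1) * k - 1 + b = (a * k + (k - 1) + b : ℕ) := by
    push_cast [h₁]; ring
  rw [h₁, sparsePolynomial_mul_shiftedS, h₂, h₃, mul_add, map_add,
    ballotFunctional_X_pow_mul_shiftedS]
  split_ifs
  · simp
  · rw [ballotFunctional_X_pow_mul_shiftedS]

/-- Reversal of each of the `m` consecutive blocks of length `k` in `Fin (m * k)`. -/
def blockRev (m k : ℕ) : Equiv.Perm (Fin (m * k)) :=
  finProdFinEquiv.permCongr (Equiv.prodCongrRight fun _ : Fin m => Fin.revPerm)

theorem sign_blockRev (m k : ℕ) :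
    Equiv.Perm.sign (blockRev m k) = (-1) ^ (m * k.choose 2) := by
  rw [blockRev, Equiv.Perm.sign_permCongr, Equiv.Perm.sign_prodCongrRight]
  simp [sign_fin_revPerm, ← pow_mul, mul_comm]

theorem blockRev_val {m k : ℕ} (i : Fin (m * k)) :
    (blockRev m k i : ℕ) = k - 1 - i % k + k * (i / k) := by
  simp [blockRev, Equiv.permCongr_apply, Fin.val_rev]
  omega

/-- The Hankel matrix of the ballot numbers. -/
def ballotHankel (n k : ℕ) : Matrix (Fin n) (Fin n) ℚ :=
  Matrix.of fun i j => ballotNumber (i + j) k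

theorem det_ballotHankel_mul (m : ℕ) {k : ℕ} (hk : 0 < k) :
    (ballotHankel (m * k) k).det = (-1) ^ (m * k.choose 2) := by
  set Q : Matrix (Fin (m * k)) (Fin (m * k)) ℚ :=
    Matrix.of fun i j => (sparsePolynomial k ((j : ℕ) / k) (j % k)).coeff i with hQ
  have hdeg (i : ℕ) : (sparsePolynomial k (i / k) (i % k)).natDegree = i := by
    rw [(monic_natDegree_sparsePolynomial hk _ _).2, Nat.div_add_mod']
  have hQdet : Q.det = 1 := Matrix.det_matrixOfPolynomials
    (fun j : Fin (m * k) => sparsePolynomial k ((j : ℕ) / k) (j % k)) (fun j => hdeg j)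
    (fun j => (monic_natDegree_sparsePolynomial hk _ _).1)
  have hmul (i j : Fin (m * k)) : (Q.transpose * ballotHankel (m * k) k) (blockRev m k i) j =
      ballotNumber j (i + 1) + if k - 1 - (i : ℕ) % k = 0 then 0 else
        ballotNumber j ((i : ℕ) / k * k + (k - 1) + (k - 1 - i % k) + 1) := by
    have hmod := Nat.mod_lt i hk
    have hi := Nat.div_add_mod' (i : ℕ) k
    have hlt : k - 1 - (i : ℕ) % k < k := by omega
    have hd : (blockRev m k i : ℕ) / k = i / k := by
      rw [blockRev_val, Nat.add_mul_div_left _ _ hk, Nat.div_eq_of_lt hlt, zero_add]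
    have hr : (blockRev m k i : ℕ) % k = k - 1 - i % k := by
      rw [blockRev_val, Nat.add_mul_mod_self_left, Nat.mod_eq_of_lt hlt]
    have hs := sum_coeff_mul_ballotNumber (n := m * k)
      (f := sparsePolynomial k ((i : ℕ) / k) (k - 1 - i % k))
      (by rw [← hd, ← hr, hdeg]; exact (blockRev m k i).2) j (k - 1)
    rw [ballotFunctional_sparsePolynomial hlt, Nat.sub_add_cancel hk,
      show (i : ℕ) / k * k + (k - 1 - (k - 1 - i % k)) = i by omega] at hs
    rw [← hs, Matrix.mul_apply]
    simp [hQ, ballotHankel, hd, hr]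
  have htri : ((Q.transpose * ballotHankel (m * k) k).submatrix (blockRev m k) id).det = 1 := by
    have hlast (i : Fin (m * k)) (j : ℕ) (hj : j ≤ i) :
        (if k - 1 - (i : ℕ) % k = 0 then (0 : ℚ) else
          ballotNumber j ((i : ℕ) / k * k + (k - 1) + (k - 1 - i % k) + 1)) = 0 := by
      have hi := Nat.div_add_mod' (i : ℕ) k
      split_ifs
      · rfl
      · exact ballotNumber_of_lt (by omega)
    rw [Matrix.det_of_isUpperTriangular]
    · refine Finset.prod_eq_one fun i _ => ?_
      rw [Matrix.submatrix_apply, id, hmul, hlast i i le_rfl, ballotNumber_succ_self, add_zero]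
    · intro i j hij
      have hij : (j : ℕ) < i := hij
      rw [Matrix.submatrix_apply, id, hmul, hlast i j hij.le, ballotNumber_of_lt (by omega),
        add_zero]
  rw [Matrix.det_permute, Matrix.det_mul, Matrix.det_transpose, hQdet, one_mul,
    sign_blockRev] at htri
  push_cast at htri
  rcases neg_one_pow_eq_or ℚ (m * k.choose 2) with h | h <;> rw [h] at htri ⊢ <;> linarith

theorem det_ballotHankel_of_not_dvd {n k : ℕ} (hk : 0 < k) (hkn : ¬ k ∣ n) :
    (ballotHankel n k).det = 0 := by
  obtain ⟨hmonic, hdeg⟩ := monic_natDegree_shiftedSQuotient hk (n / k)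
  have hn := Nat.div_add_mod' n k
  have hmod : 0 < n % k := Nat.pos_of_ne_zero fun h => hkn (Nat.dvd_of_mod_eq_zero h)
  have hlt := Nat.mod_lt n hk
  refine Matrix.exists_vecMul_eq_zero_iff.1
    ⟨fun l => (shiftedSQuotient k (n / k)).coeff l, fun h => ?_, ?_⟩
  · have h₁ := congrFun h ⟨n / k * k, by omega⟩
    simp only [← hdeg, coeff_natDegree, hmonic.leadingCoeff] at h₁
    exact one_ne_zero h₁
  · ext j
    have hs := sum_coeff_mul_ballotNumber (n := n) (f := shiftedSQuotient k (n / k))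
      (by omega) j (k - 1)
    have hc : ((n / k : ℕ) + 1 : ℤ) * k - 1 = (n / k * k + (k - 1) : ℕ) := by
      push_cast [show ((k - 1 : ℕ) : ℤ) = k - 1 by omega]; ring
    rw [show ((k - 1 : ℕ) : ℤ) = k - 1 by omega, shiftedSQuotient_mul_shiftedS, hc,
      ballotFunctional_X_pow_mul_shiftedS, Nat.sub_add_cancel hk,
      ballotNumber_of_lt (by omega)] at hs
    simpa [Matrix.vecMul, dotProduct, ballotHankel] using hs

/-- Corollary 15: the determinant of the `n×n` matrix with `(i,j)`-entry
`(2k)/(i+j+k+1)·C(2i+2j+1, i+j+k)`, computed in `ℚ`, equals `(−1)^{n₁·C(k,2)}`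
if `n = n₁k` with `n₁ ≥ 1`, and `0` if `k ∤ n`. -/
theorem det_ballot_hankel_mid (n : ℕ) (hn : 0 < n) (k : ℕ) (hk : 0 < k) :
    (∀ n₁ : ℕ, 0 < n₁ → n = n₁ * k →
      Matrix.det (Matrix.of fun i j : Fin n =>
          ((2 * k : ℚ) / ((i.1 + j.1 + k + 1 : ℕ) : ℚ)) *
            ((2 * i.1 + 2 * j.1 + 1).choose (i.1 + j.1 + k) : ℚ)) =
        (-1 : ℚ) ^ (n₁ * Nat.choose k 2)) ∧
    (¬ k ∣ n →
      Matrix.det (Matrix.of fun i j : Fin n =>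
          ((2 * k : ℚ) / ((i.1 + j.1 + k + 1 : ℕ) : ℚ)) *
            ((2 * i.1 + 2 * j.1 + 1).choose (i.1 + j.1 + k) : ℚ)) = 0) := by
  have h : (Matrix.of fun i j : Fin n =>
      ((2 * k : ℚ) / ((i.1 + j.1 + k + 1 : ℕ) : ℚ)) *
        ((2 * i.1 + 2 * j.1 + 1).choose (i.1 + j.1 + k) : ℚ)) = ballotHankel n k := by
    ext i j
    simp only [Matrix.of_apply, ballotHankel, ← ballotNumber_eq, mul_add]
  rw [h]
  refine ⟨?_, det_ballotHankel_of_not_dvd hk⟩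
  rintro n₁ - rfl
  exact det_ballotHankel_mul n₁ hk
end

section
/- For all positive integers n and k, the n×n determinant det_{0≤i,j≤n−1}( C(2i+2j, i+j+k) ) equals (−1)^{n₁k} if n = 2n₁k for a positive integer n₁; equals (−1)^{n₁k+C(k,2)} if n = 2n₁k−k+1 for a positive integer n₁; and equals 0 if n is congruent to neither 0 nor k+1 modulo 2k. For k = 0, det_{0≤i,j≤n−1}( C(2i+2j, i+j) ) = 2^{n−1}. -/
section

open Matrix Finset

/-- The matrix of constant terms of `x ^ k * p a * p b`, where `p 0 = 1` and
`p a = x ^ a + x ^ (-a)` for `0 < a`. In natural-number subtraction,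
`(k - b) + (b - k)` is the distance between `k` and `b`. -/
def chebyshevGram (k n : ℕ) : Matrix (Fin n) (Fin n) ℤ :=
  Matrix.of fun a b => (if a.1 = (k - b.1) + (b.1 - k) then 1 else 0) +
    if b.1 ≠ 0 ∧ a.1 = b.1 + k then 1 else 0

/-- The matrix of coefficients of `(x + 2 + x⁻¹) ^ i` in the basis `p a` of
`chebyshevGram`. -/
def centralChoose (n : ℕ) : Matrix (Fin n) (Fin n) ℤ :=
  Matrix.of fun i a => ((2 * i.1).choose (i.1 + a.1) : ℤ)

theorem det_centralChoose (n : ℕ) : (centralChoose n).det = 1 := by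
  rw [Matrix.det_of_isLowerTriangular]
  · simp [centralChoose, ← two_mul]
  · intro i j h
    have h : i.1 < j.1 := h
    simp only [centralChoose, Matrix.of_apply, Nat.cast_eq_zero]
    exact Nat.choose_eq_zero_of_lt (by omega)

theorem sum_range_two_mul_add_one {M : Type*} [AddCommMonoid M] (f : ℕ → M) (j : ℕ) :
    ∑ q ∈ range (2 * j + 1), f q =
      ∑ b ∈ range (j + 1), (f (j + b) + if b ≠ 0 then f (j - b) else 0) := by
  rw [sum_add_distrib, sum_range_succ' (fun b => if b ≠ 0 then f (j - b) else 0),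
    show 2 * j + 1 = j + (j + 1) by ring, sum_range_add, add_comm, ← sum_range_reflect f j]
  simp only [ne_eq, Nat.add_eq_zero_iff, one_ne_zero, and_false, not_false_eq_true, if_true,
    not_true_eq_false, if_false, add_zero]
  congr 1
  refine sum_congr rfl fun b _ => ?_
  congr 1
  omega

/-- Vandermonde's identity with the sum folded about its centre. -/
theorem choose_two_mul_add_two_mul (i j k : ℕ) :
    (2 * i + 2 * j).choose (i + j + k) = ∑ b ∈ range (j + 1), (2 * j).choose (j + b) *
      ((2 * i).choose (i + ((k - b) + (b - k))) +
        if b ≠ 0 then (2 * i).choose (i + (b + k)) else 0) := by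
  have key : (2 * i + 2 * j).choose (i + j + k) = ∑ q ∈ range (2 * j + 1),
      (2 * j).choose q * if q ≤ i + j + k then (2 * i).choose (i + j + k - q) else 0 := by
    rw [add_comm, Nat.add_choose_eq, Nat.sum_antidiagonal_eq_sum_range_succ
      (fun a b => (2 * j).choose a * (2 * i).choose b)]
    simp only [mul_ite, mul_zero]
    rw [← sum_filter]
    symm
    apply sum_subset_zero_on_sdiff
    · intro q
      simp
    · intro q hq
      simp only [mem_sdiff, mem_range, mem_filter, not_and, not_le] at hq
      rw [Nat.choose_eq_zero_of_lt (by omega), zero_mul]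
    · intros; rfl
  rw [key, sum_range_two_mul_add_one]
  refine sum_congr rfl fun b hb => ?_
  rw [mem_range] at hb
  rw [mul_add]
  congr 1
  · congr 1
    split_ifs with h
    · rcases le_total b k with hk | hk
      · congr 1; omega
      · rw [← Nat.choose_symm (by omega)]; congr 1; omega
    · rw [Nat.choose_eq_zero_of_lt (by omega)]
  · split_ifs with h1 h2
    · rw [← Nat.choose_symm (n := 2 * j) (by omega)]
      congr 2 <;> omega
    · omega
    · simp

theorem hankel_eq_centralChoose_mul_chebyshevGram_mul (n k : ℕ) :
    (Matrix.of fun i j : Fin n => ((2 * i.1 + 2 * j.1).choose (i.1 + j.1 + k) : ℤ)) =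
      centralChoose n * chebyshevGram k n * (centralChoose n)ᵀ := by
  have hsum (i : Fin n) (f : ℕ) : ∑ a : Fin n, ((2 * i.1).choose (i.1 + a.1) : ℤ) *
      (if a.1 = f then 1 else 0) = ((2 * i.1).choose (i.1 + f) : ℤ) := by
    rw [Fin.sum_univ_eq_sum_range
      (fun a => ((2 * i.1).choose (i.1 + a) : ℤ) * (if a = f then 1 else 0)) n]
    simp only [mul_ite, mul_one, mul_zero, sum_ite_eq', mem_range]
    split_ifs with h
    · rfl
    · rw [Nat.choose_eq_zero_of_lt (by omega), Nat.cast_zero]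
  ext i j
  have hinner (b : Fin n) : (centralChoose n * chebyshevGram k n) i b =
      ((2 * i.1).choose (i.1 + ((k - b.1) + (b.1 - k))) : ℤ) +
        if b.1 ≠ 0 then ((2 * i.1).choose (i.1 + (b.1 + k)) : ℤ) else 0 := by
    simp only [Matrix.mul_apply, centralChoose, chebyshevGram, Matrix.of_apply, mul_add,
      sum_add_distrib, hsum, ite_and]
    split_ifs
    · rw [hsum]
    · simp
  rw [Matrix.mul_apply]
  simp only [hinner, transpose_apply]
  simp only [centralChoose, Matrix.of_apply]
  rw [Fin.sum_univ_eq_sum_range (fun b => (((2 * i.1).choose (i.1 + ((k - b) + (b - k))) : ℤ) +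
        if b ≠ 0 then ((2 * i.1).choose (i.1 + (b + k)) : ℤ) else 0) *
        ((2 * j.1).choose (j.1 + b) : ℤ)) n, choose_two_mul_add_two_mul]
  push_cast
  symm
  rw [← sum_subset (range_subset_range.2 (Nat.succ_le_of_lt j.2))]
  · exact sum_congr rfl fun b _ => mul_comm _ _
  · intro b _ hb
    rw [mem_range] at hb
    rw [Nat.choose_eq_zero_of_lt (n := 2 * j.1) (by omega), Nat.cast_zero, mul_zero]

theorem det_hankel_eq_det_chebyshevGram (n k : ℕ) :
    (Matrix.of fun i j : Fin n => ((2 * i.1 + 2 * j.1).choose (i.1 + j.1 + k) : ℤ)).det =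
      (chebyshevGram k n).det := by
  rw [hankel_eq_centralChoose_mul_chebyshevGram_mul, det_mul, det_mul, det_transpose,
    det_centralChoose, one_mul, mul_one]

theorem det_bordered {R m l : Type*} [CommRing R] [Fintype m] [DecidableEq m]
    [Fintype l] [DecidableEq l] (A : Matrix m m R) (B : Matrix m l R) (C : Matrix l m R)
    (E : Matrix l l R) :
    (fromBlocks A (fromCols B (0 : Matrix m l R)) (fromRows C (0 : Matrix l m R))
      (fromBlocks E (1 : Matrix l l R) (1 : Matrix l l R) (0 : Matrix l l R))).det =
      (-1) ^ Fintype.card l * A.det := by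
  have hE : (fromBlocks E 1 1 0 : Matrix (l ⊕ l) (l ⊕ l) R).det = (-1) ^ Fintype.card l := by
    have h : (fromBlocks E 1 1 0 : Matrix (l ⊕ l) (l ⊕ l) R) * fromBlocks 1 0 (1 - E) 1 =
        fromBlocks 1 1 1 0 := by simp [fromBlocks_multiply]
    have h' := congr_arg Matrix.det h
    simpa [det_fromBlocks_one₁₁, det_neg] using h'
  have h : fromBlocks A (fromCols B (0 : Matrix m l R)) (fromRows C (0 : Matrix l m R))
      (fromBlocks E (1 : Matrix l l R) (1 : Matrix l l R) (0 : Matrix l l R)) *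
      fromBlocks 1 0 (fromRows 0 (-C)) 1 =
      fromBlocks A (fromCols B 0) 0 (fromBlocks E 1 1 0) := by
    have hC : fromRows C (0 : Matrix l m R) + fromRows (-C) 0 = 0 := by
      ext (i | i) j <;> simp
    simp [fromBlocks_multiply, fromCols_mul_fromRows, fromBlocks_mul_fromRows, hC]
  have h' := congr_arg Matrix.det h
  rw [det_mul, det_fromBlocks_zero₁₂, det_fromBlocks_zero₂₁, hE] at h'
  simpa [mul_comm] using h'

theorem det_chebyshevGram_add (k n : ℕ) :
    (chebyshevGram k (n + (k + k))).det = (-1) ^ k * (chebyshevGram k n).det := by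
  let e : Fin n ⊕ (Fin k ⊕ Fin k) ≃ Fin (n + (k + k)) :=
    (Equiv.sumCongr (Equiv.refl _) finSumFinEquiv).trans finSumFinEquiv
  rw [← det_submatrix_equiv_self e]
  have h : (chebyshevGram k (n + (k + k))).submatrix e e = fromBlocks (chebyshevGram k n)
      (fromCols (of fun a b => chebyshevGram k (n + (k + k)) (e (.inl a)) (e (.inr (.inl b)))) 0)
      (fromRows (of fun a b => chebyshevGram k (n + (k + k)) (e (.inr (.inl a))) (e (.inl b))) 0)
      (fromBlocks (of fun a b =>
        chebyshevGram k (n + (k + k)) (e (.inr (.inl a))) (e (.inr (.inl b)))) 1 1 0) := by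
    ext (a | a | a) (b | b | b) <;> try rfl
    all_goals
      have := a.2
      have := b.2
      simp [chebyshevGram, e, Matrix.one_apply, Fin.ext_iff]
      grind
  rw [h, det_bordered, Fintype.card_fin]

theorem det_antidiagonal {R : Type*} [CommRing R] (k : ℕ) :
    (of fun a b : Fin k => if a.1 + b.1 + 1 = k then (1 : R) else 0).det =
      (-1) ^ k.choose 2 := by
  induction k with
  | zero => simp
  | succ k ih =>
    rw [det_succ_row_zero, Fin.sum_univ_castSucc, sum_eq_zero, zero_add]
    · have h : (of fun a b : Fin (k + 1) => if a.1 + b.1 + 1 = k + 1 then (1 : R) else 0).submatrix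
          Fin.succ (Fin.last k).succAbove =
          of fun a b : Fin k => if a.1 + b.1 + 1 = k then (1 : R) else 0 := by
        ext a b
        simp [add_right_comm]
      rw [h, ih, Nat.choose_succ_succ' k 1]
      simp [pow_add]
    · intro b _
      simp [b.2.ne]

theorem det_chebyshevGram_succ (k : ℕ) :
    (chebyshevGram k (k + 1)).det = (-1) ^ (k + k.choose 2) := by
  rw [show k + k.choose 2 = (k + 1).choose 2 by simp [Nat.choose_succ_succ' k 1],
    ← det_antidiagonal]
  congr 1
  ext a b
  have := a.2
  have := b.2
  simp only [chebyshevGram, of_apply]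
  grind

theorem det_chebyshevGram_add_mul (k n m : ℕ) :
    (chebyshevGram k (n + 2 * k * m)).det = (-1) ^ (m * k) * (chebyshevGram k n).det := by
  induction m with
  | zero => simp
  | succ m ih =>
    rw [show n + 2 * k * (m + 1) = n + 2 * k * m + (k + k) by ring, det_chebyshevGram_add, ih,
      add_mul, pow_add, one_mul]
    ring

theorem det_chebyshevGram_eq_zero {k n : ℕ} (hn : 0 < n) (hnk : n < 2 * k) (hne : n ≠ k + 1) :
    (chebyshevGram k n).det = 0 := by
  rcases le_or_gt n k with h | h
  · refine det_eq_zero_of_row_eq_zero ⟨0, hn⟩ fun b => ?_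
    have := b.2
    simp only [chebyshevGram, of_apply]
    grind
  · refine det_zero_of_row_eq (i := ⟨k - 1, by omega⟩) (j := ⟨k + 1, by omega⟩)
      (by simp) ?_
    ext b
    have := b.2
    simp only [chebyshevGram, of_apply]
    grind

theorem det_chebyshevGram_zero (n : ℕ) : (chebyshevGram 0 (n + 1)).det = 2 ^ n := by
  have h : chebyshevGram 0 (n + 1) = diagonal (Fin.cons 1 fun _ => 2) := by
    ext a b
    simp only [chebyshevGram, of_apply, diagonal_apply]
    refine Fin.cases ?_ (fun a => ?_) a <;> refine Fin.cases ?_ (fun b => ?_) b <;>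
      simp [Fin.ext_iff]
    grind
  rw [h, det_diagonal, Fin.prod_univ_succ]
  simp

end

/-- Corollary 19: `det_{0≤i,j≤n−1}( C(2i+2j, i+j+k) )` in `ℤ`.
The hypothesis `n = 2n₁k−k+1` is stated additively as `n + k = 2n₁k + 1`. -/
theorem det_central_binomial_hankel (n : ℕ) (hn : 0 < n) :
    (∀ k : ℕ, 0 < k →
      (∀ n₁ : ℕ, 0 < n₁ → n = 2 * n₁ * k →
        Matrix.det (Matrix.of fun i j : Fin n =>
            ((2 * i.1 + 2 * j.1).choose (i.1 + j.1 + k) : ℤ)) =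
          (-1 : ℤ) ^ (n₁ * k)) ∧
      (∀ n₁ : ℕ, 0 < n₁ → n + k = 2 * n₁ * k + 1 →
        Matrix.det (Matrix.of fun i j : Fin n =>
            ((2 * i.1 + 2 * j.1).choose (i.1 + j.1 + k) : ℤ)) =
          (-1 : ℤ) ^ (n₁ * k + Nat.choose k 2)) ∧
      (n % (2 * k) ≠ 0 ∧ n % (2 * k) ≠ (k + 1) % (2 * k) →
        Matrix.det (Matrix.of fun i j : Fin n =>
            ((2 * i.1 + 2 * j.1).choose (i.1 + j.1 + k) : ℤ)) = 0)) ∧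
    Matrix.det (Matrix.of fun i j : Fin n =>
        ((2 * i.1 + 2 * j.1).choose (i.1 + j.1) : ℤ)) = 2 ^ (n - 1) := by
  refine ⟨fun k hk => ⟨fun n₁ _ h => ?_, fun n₁ h₁ h => ?_, fun ⟨h0, h1⟩ => ?_⟩, ?_⟩
  · rw [det_hankel_eq_det_chebyshevGram, show n = 0 + 2 * k * n₁ by rw [h]; ring,
      det_chebyshevGram_add_mul]
    simp
  · obtain ⟨m, rfl⟩ := Nat.exists_eq_add_of_lt h₁
    have hm : n = k + 1 + 2 * k * m := by linarith
    rw [det_hankel_eq_det_chebyshevGram, hm, det_chebyshevGram_add_mul,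
      det_chebyshevGram_succ, ← pow_add]
    congr 1
    ring
  · rw [det_hankel_eq_det_chebyshevGram, ← Nat.mod_add_div n (2 * k), det_chebyshevGram_add_mul,
      det_chebyshevGram_eq_zero (Nat.pos_of_ne_zero h0) (Nat.mod_lt _ (by omega)), mul_zero]
    intro h
    exact h1 (by rw [← h, Nat.mod_mod])
  · obtain ⟨m, rfl⟩ := Nat.exists_eq_succ_of_ne_zero hn.ne'
    simpa [det_chebyshevGram_zero] using det_hankel_eq_det_chebyshevGram (m + 1) 0
end

section
/- Let R be a commutative ring and t ∈ R. For all positive integers n and nonnegative integers k, the n×n determinant det_{0≤i,j≤n−1}( C(2j, j+k−i) − t·C(2j, j+k+i+2) ) (the binomial coefficients regarded as elements of R) equals (−1)^{n₁·C(k+1,2)}·t^{k⌊n₁/2⌋} if n = n₁(k+1) for a positive integer n₁, and equals 0 if k+1 does not divide n. -/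
/-- `chooseZ a b` is the binomial coefficient `C(a,b)` for an integer lower index `b`,
with the convention that it vanishes unless `0 ≤ b ≤ a`. -/
def chooseZ (a : ℕ) (b : ℤ) : ℕ :=
  if 0 ≤ b then a.choose b.toNat else 0

/-- The matrix of the coefficient functionals `[x^{k-i}] - t [x^{k+i+2}]` evaluated at the Laurent
polynomials `1` (for `j = 0`) and `x^j + x^{-j}` (for `j > 0`). -/
def reflEntry {R : Type*} [CommRing R] (t : R) (k i j : ℕ) : R :=
  (if i + j = k ∨ i = j + k then 1 else 0) - t * (if j = i + k + 2 then 1 else 0)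

/-- The `n × n` matrix with entries `reflEntry t k i j`. -/
def reflMatrix {R : Type*} [CommRing R] (t : R) (k n : ℕ) : Matrix (Fin n) (Fin n) R :=
  Matrix.of fun i j => reflEntry t k i j

theorem chooseZ_sub (j k i : ℕ) :
    chooseZ (2 * j) ((j : ℤ) + k - i) = (2 * j).choose (j + Nat.dist k i) := by
  unfold chooseZ
  split_ifs with h
  · rcases le_total i k with hik | hik
    · rw [Nat.dist_eq_sub_of_le_right hik]
      congr 1
      omega
    · rw [Nat.dist_eq_sub_of_le hik]
      apply Nat.choose_symm_of_eq_add
      omega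
  · rw [Nat.dist_eq_sub_of_le (by omega), Nat.choose_eq_zero_of_lt (by omega)]

theorem sum_ite_mul_choose {R : Type*} [CommRing R] {n j : ℕ} (hj : j < n) (m : ℕ) :
    ∑ l : Fin n, (if l.1 = m then (1 : R) else 0) * ((2 * j).choose (j + l) : R) =
      ((2 * j).choose (j + m) : R) := by
  rw [Fin.sum_univ_eq_sum_range
    (fun l => (if l = m then (1 : R) else 0) * ((2 * j).choose (j + l) : R))]
  simp only [ite_mul, one_mul, zero_mul, Finset.sum_ite_eq', Finset.mem_range]
  split_ifs with h
  · rfl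
  · rw [Nat.choose_eq_zero_of_lt (by omega), Nat.cast_zero]

theorem det_choose_upperTriangular {R : Type*} [CommRing R] (n : ℕ) :
    Matrix.det (Matrix.of fun l j : Fin n => ((2 * j.1).choose (j.1 + l.1) : R)) = 1 := by
  rw [Matrix.det_of_isUpperTriangular]
  · exact Finset.prod_eq_one fun i _ => by simp [← two_mul]
  · intro i j hij
    have hij' : j.1 < i.1 := hij
    simp [Nat.choose_eq_zero_of_lt (show 2 * j.1 < j.1 + i.1 by omega)]

theorem det_binomial_eq_det_reflMatrix {R : Type*} [CommRing R] (t : R) (n k : ℕ) :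
    Matrix.det (Matrix.of fun i j : Fin n =>
        (chooseZ (2 * j.1) ((j.1 : ℤ) + k - i.1) : R) -
          t * ((2 * j.1).choose (j.1 + k + i.1 + 2) : R)) = (reflMatrix t k n).det := by
  rw [← mul_one (reflMatrix t k n).det, ← det_choose_upperTriangular n, ← Matrix.det_mul]
  congr 1
  ext i j
  have hdist (l : ℕ) : (i.1 + l = k ∨ i.1 = l + k) ↔ l = Nat.dist k i := by
    unfold Nat.dist
    omega
  simp only [Matrix.mul_apply, Matrix.of_apply, reflMatrix, reflEntry, hdist, sub_mul, mul_assoc,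
    Finset.sum_sub_distrib, ← Finset.mul_sum, sum_ite_mul_choose j.2, chooseZ_sub]
  congr 4
  omega

theorem det_antidiagonal_s19 {R : Type*} [CommRing R] (n : ℕ) :
    Matrix.det (Matrix.of fun i j : Fin n => if i.1 + j.1 + 1 = n then (1 : R) else 0) =
      (-1) ^ n.choose 2 := by
  induction n with
  | zero => simp
  | succ n ih =>
    rw [Matrix.det_succ_column_zero, Finset.sum_eq_single (Fin.last n)]
    · have hsub : (Matrix.of fun i j : Fin (n + 1) =>
          if i.1 + j.1 + 1 = n + 1 then (1 : R) else 0).submatrix (Fin.last n).succAbove Fin.succ =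
          Matrix.of fun i j : Fin n => if i.1 + j.1 + 1 = n then (1 : R) else 0 := by
        ext i j
        simp [← add_assoc]
      rw [hsub, ih]
      simp [Nat.choose_succ_succ' n 1, pow_add]
    · intro i _ hi
      have : i.1 ≠ n := fun h => hi (Fin.ext h)
      simp [this]
    · simp

theorem finRotate_pow_apply {n : ℕ} (m : ℕ) (i : Fin n) :
    ((finRotate n ^ m) i : ℕ) = (i + m) % n := by
  induction m with
  | zero => simp [Nat.mod_eq_of_lt i.2]
  | succ m ih =>
    obtain ⟨n, rfl⟩ := Nat.exists_eq_succ_of_ne_zero i.pos.ne'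
    rw [pow_succ', Equiv.Perm.mul_apply, finRotate_apply, Fin.val_add, ih, Fin.val_one']
    simp [← add_assoc]

theorem det_reflMatrix_add {R : Type*} [CommRing R] (t : R) (k N : ℕ) :
    (reflMatrix t k (N + (k + 2 + k))).det = t ^ k * (reflMatrix t k N).det := by
  let G := (reflMatrix t k (N + (k + 2 + k))).submatrix finSumFinEquiv finSumFinEquiv
  let τ : Equiv.Perm (Fin N ⊕ Fin (k + 2 + k)) :=
    Equiv.sumCongr (Equiv.refl _) (finRotate (k + 2 + k) ^ k)
  let e : (Fin N ⊕ Fin (k + 2)) ⊕ Fin k ≃ Fin N ⊕ Fin (k + 2 + k) :=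
    (Equiv.sumAssoc _ _ _).trans (Equiv.sumCongr (Equiv.refl _) finSumFinEquiv)
  have hG : G.det = (reflMatrix t k (N + (k + 2 + k))).det := Matrix.det_submatrix_equiv_self _ _
  have hsign : ((Equiv.Perm.sign τ : ℤ) : R) = (-1) ^ k := by
    have h1 : k + 2 + k - 1 = 2 * k + 1 := by omega
    have h2 : Equiv.Perm.sign τ = (-1) ^ k := by
      rw [Equiv.Perm.sign_sumCongr, Equiv.Perm.sign_refl, one_mul, map_pow, sign_finRotate, h1]
      simp [pow_succ, pow_mul]
    simp [h2]
  have hrot (r : Fin (k + 2 + k)) :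
      ((finRotate (k + 2 + k) ^ k) r : ℕ) = if r.1 < k + 2 then r + k else r - (k + 2) := by
    have hr := r.2
    rw [finRotate_pow_apply]
    split_ifs with hlt
    · exact Nat.mod_eq_of_lt (by omega)
    · rw [Nat.mod_eq_sub_mod (by omega), Nat.mod_eq_of_lt (by omega)]
      omega
  have hblocks : (G.submatrix τ id).submatrix e e = Matrix.fromBlocks
      (Matrix.fromBlocks (reflMatrix t k N)
        (Matrix.of fun (i : Fin N) (j : Fin (k + 2)) => reflEntry t k i (N + j)) 0 1) 0
      (Matrix.of fun (i : Fin k) (j : Fin N ⊕ Fin (k + 2)) =>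
        reflEntry t k (N + i) (Sum.elim (fun a => a.1) (fun b => N + b.1) j)) (-t • 1) := by
    ext ((i | i) | i) ((j | j) | j) <;> have hi := i.2 <;> have hj := j.2 <;>
      simp [G, τ, e, reflMatrix, hrot, Matrix.one_apply, Fin.ext_iff] <;>
      simp only [reflEntry]
    all_goals split_ifs <;> first | (exfalso; omega) | simp
  have hdet := congrArg Matrix.det hblocks
  rw [Matrix.det_submatrix_equiv_self, Matrix.det_permute, hsign, hG,
    Matrix.det_fromBlocks_zero₁₂, Matrix.det_fromBlocks_zero₂₁, Matrix.det_one, mul_one,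
    Matrix.det_smul, Matrix.det_one, mul_one, Fintype.card_fin] at hdet
  calc _ = (-1) ^ k * ((-1) ^ k * (reflMatrix t k (N + (k + 2 + k))).det) := by
        rw [← mul_assoc, ← mul_pow]
        simp
    _ = _ := by
        rw [hdet, mul_left_comm, ← mul_pow, neg_one_mul, neg_neg, mul_comm]

theorem det_reflMatrix_self {R : Type*} [CommRing R] (t : R) (k : ℕ) :
    (reflMatrix t k (k + 1)).det = (-1) ^ (k + 1).choose 2 := by
  rw [← det_antidiagonal_s19]
  congr 1
  ext i j
  have h1 : ¬ j.1 = i.1 + k + 2 := by omega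
  have h2 : (i.1 + j.1 = k ∨ i.1 = j.1 + k) ↔ i.1 + j.1 + 1 = k + 1 := by omega
  simp [reflMatrix, reflEntry, h1, h2]

theorem det_reflMatrix_mul {R : Type*} [CommRing R] (t : R) (k m : ℕ) :
    (reflMatrix t k (m * (k + 1))).det =
      (-1) ^ (m * (k + 1).choose 2) * t ^ (k * (m / 2)) := by
  induction m using Nat.twoStepInduction with
  | zero =>
    rw [zero_mul]
    simp
  | one =>
    rw [one_mul, det_reflMatrix_self]
    simp
  | more m ih _ =>
    rw [show (m + 2) * (k + 1) = m * (k + 1) + (k + 2 + k) by ring, det_reflMatrix_add, ih,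
      Nat.add_div_right m two_pos, add_mul, pow_add, pow_mul _ 2, neg_one_sq, one_pow, mul_one,
      Nat.mul_succ, pow_add]
    ring

theorem det_reflMatrix_eq_zero {R : Type*} [CommRing R] (t : R) (k n : ℕ)
    (h : ¬ (k + 1) ∣ n) : (reflMatrix t k n).det = 0 := by
  induction n using Nat.strong_induction_on with
  | _ n ih =>
    have hn0 : n ≠ 0 := by
      rintro rfl
      exact h (dvd_zero _)
    have hnk : n ≠ k + 1 := by
      rintro rfl
      exact h dvd_rfl
    rcases lt_or_ge n (k + 2 + k) with hlt | hge
    · rcases lt_or_ge n (k + 1) with hlt' | hge'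
      · refine Matrix.det_eq_zero_of_column_eq_zero ⟨0, by omega⟩ fun i => ?_
        have h1 : ¬ (i.1 + 0 = k ∨ i.1 = 0 + k) := by omega
        have h2 : ¬ 0 = i.1 + k + 2 := by omega
        simp only [reflMatrix, reflEntry, Matrix.of_apply, if_neg h1, if_neg h2, mul_zero, sub_zero]
      · refine Matrix.det_eq_zero_of_column_eq_zero ⟨k + 1, by omega⟩ fun i => ?_
        have h1 : ¬ (i.1 + (k + 1) = k ∨ i.1 = k + 1 + k) := by omega
        have h2 : ¬ k + 1 = i.1 + k + 2 := by omega
        simp only [reflMatrix, reflEntry, Matrix.of_apply, if_neg h1, if_neg h2, mul_zero, sub_zero]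
    · obtain ⟨N, rfl⟩ := Nat.exists_eq_add_of_le' hge
      rw [det_reflMatrix_add, ih N (by omega), mul_zero]
      intro hN
      exact h (dvd_add hN ⟨2, by ring⟩)

/-- Corollary 26: for `t` in a commutative ring `R`,
`det_{0≤i,j≤n−1}( C(2j, j+k−i) − t·C(2j, j+k+i+2) )` equals
`(−1)^{n₁·C(k+1,2)}·t^{k⌊n₁/2⌋}` if `n = n₁(k+1)` with `n₁ ≥ 1`, and `0` if `k+1 ∤ n`. -/
theorem det_binomial_diff {R : Type*} [CommRing R] (t : R) (n : ℕ) (hn : 0 < n) (k : ℕ) :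
    (∀ n₁ : ℕ, 0 < n₁ → n = n₁ * (k + 1) →
      Matrix.det (Matrix.of fun i j : Fin n =>
          (chooseZ (2 * j.1) ((j.1 : ℤ) + k - i.1) : R) -
            t * ((2 * j.1).choose (j.1 + k + i.1 + 2) : R)) =
        (-1 : R) ^ (n₁ * Nat.choose (k + 1) 2) * t ^ (k * (n₁ / 2))) ∧
    (¬ (k + 1) ∣ n →
      Matrix.det (Matrix.of fun i j : Fin n =>
          (chooseZ (2 * j.1) ((j.1 : ℤ) + k - i.1) : R) -
            t * ((2 * j.1).choose (j.1 + k + i.1 + 2) : R)) = 0) := by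
  rw [det_binomial_eq_det_reflMatrix]
  refine ⟨?_, det_reflMatrix_eq_zero t k n⟩
  rintro m _ rfl
  exact det_reflMatrix_mul t k m
end
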